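/- Let S and A be nonempty measurable spaces, r : S × A → ℝ, γ ∈ (0,1), and κ a Markov kernel from S × A to S. Let α, β ∈ [0,1] with β ≤ 1, U ⊆ S × A, and H : S × A → ℝ with H(x) > 0 and 1 ≤ β·H(x) for every x ∈ U. Let Q^Δ and Q* : S × A → ℝ be bounded functions with 𝓕Q^Δ = Q^Δ and 𝓑Q* = Q*, suppose the relevant sup-functions s' ↦ ⨆_{a'} G_{Q^Δ}(s',a'), s' ↦ ⨆_{a'} G_{Q*}(s',a'), and s' ↦ ⨆_{a'} Q*(s',a') are integrable with respect to κ(s,a) for every (s,a), and assume the event hypothesis for Q*: for every x ∈ U, |1 − 1/H(x)|·|Q*(x)| ≤ (1−β)·⨆_{y} |Q*(y)|. Then ⨆_{x ∈ S×A} |Q^Δ(x) − Q*(x)| ≤ γ·(1−α)·(1−β)·(1 − (α + (1−α)·β)·γ)⁻¹·⨆_{x ∈ S×A} |Q*(x)|. -/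

import Mathlib

open MeasureTheory ProbabilityTheory

open Classical in
/-- The blended (uncertainty-penalized) target of QDQ: on the high-uncertainty set `U` the
Q-value is weighted by `1/H`, and off `U` it is weighted by `β`, mixed with the unpenalized
value with weight `α`. -/
noncomputable def blendedTarget {X : Type*} (U : Set X) (H : X → ℝ) (α β : ℝ)
    (Q : X → ℝ) (x : X) : ℝ :=
  α * Q x + (1 - α) * (if x ∈ U then Q x / H x else β * Q x)

/-- The QDQ Bellman operator
`(𝓕Q)(s,a) = r(s,a) + γ ∫ (⨆ a', G_Q(s',a')) dκ(s,a)(s')`, where `G_Q` is the blended target. -/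
noncomputable def qdqBellman {S A : Type*} [MeasurableSpace S] [MeasurableSpace A]
    (r : S × A → ℝ) (γ : ℝ) (κ : Kernel (S × A) S) (U : Set (S × A)) (H : S × A → ℝ)
    (α β : ℝ) (Q : S × A → ℝ) (p : S × A) : ℝ :=
  r p + γ * ∫ s', (⨆ a' : A, blendedTarget U H α β Q (s', a')) ∂(κ p)

/-- The classical (optimal) Bellman operator
`(𝓑Q)(s,a) = r(s,a) + γ ∫ (⨆ a', Q(s',a')) dκ(s,a)(s')`. -/
noncomputable def classicalBellman {S A : Type*} [MeasurableSpace S] [MeasurableSpace A]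
    (r : S × A → ℝ) (γ : ℝ) (κ : Kernel (S × A) S) (Q : S × A → ℝ) (p : S × A) : ℝ :=
  r p + γ * ∫ s', (⨆ a' : A, Q (s', a')) ∂(κ p)

/-- Bounded families that are uniformly within `C` of each other have suprema within `C`. -/
lemma abs_ciSup_sub_ciSup_le {ι : Type*} [Nonempty ι] {f g : ι → ℝ} {C : ℝ}
    (hf : BddAbove (Set.range f)) (hg : BddAbove (Set.range g))
    (h : ∀ i, |f i - g i| ≤ C) : |(⨆ i, f i) - ⨆ i, g i| ≤ C := by
  have h₁ : (⨆ i, f i) ≤ (⨆ i, g i) + C := ciSup_le fun i => by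
    linarith [(abs_le.mp (h i)).2, le_ciSup hg i]
  have h₂ : (⨆ i, g i) ≤ (⨆ i, f i) + C := ciSup_le fun i => by
    linarith [(abs_le.mp (h i)).1, le_ciSup hf i]
  exact abs_le.mpr ⟨by linarith, by linarith⟩

lemma abs_integral_sub_integral_le {Ω : Type*} [MeasurableSpace Ω] {μ : Measure Ω}
    [IsProbabilityMeasure μ] {f g : Ω → ℝ} {C : ℝ} (hf : Integrable f μ) (hg : Integrable g μ)
    (h : ∀ ω, |f ω - g ω| ≤ C) : |(∫ ω, f ω ∂μ) - ∫ ω, g ω ∂μ| ≤ C := by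
  rw [← integral_sub hf hg]
  simpa using norm_integral_le_of_norm_le_const (μ := μ) (f := fun ω => f ω - g ω)
    (Filter.Eventually.of_forall h)

lemma abs_blendedTarget_sub_le {X : Type*} {U : Set X} {H : X → ℝ} {α β : ℝ}
    (hα : α ∈ Set.Icc (0 : ℝ) 1) (hβ : 0 ≤ β)
    (hH : ∀ x ∈ U, 0 < H x) (hβH : ∀ x ∈ U, 1 ≤ β * H x) (Q Q' : X → ℝ) (x : X) :
    |blendedTarget U H α β Q x - blendedTarget U H α β Q' x| ≤
      (α + (1 - α) * β) * |Q x - Q' x| := by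
  obtain ⟨hα₀, hα₁⟩ := hα
  have hα₂ : 0 ≤ 1 - α := by linarith
  obtain ⟨w, hw₀, hwβ, hw⟩ : ∃ w : ℝ, 0 ≤ w ∧ w ≤ β ∧
      ∀ P : X → ℝ, blendedTarget U H α β P x = (α + (1 - α) * w) * P x := by
    by_cases hx : x ∈ U
    · refine ⟨1 / H x, (one_div_pos.mpr (hH x hx)).le, (div_le_iff₀ (hH x hx)).mpr (hβH x hx),
        fun P => ?_⟩
      rw [blendedTarget, if_pos hx]
      ring
    · refine ⟨β, hβ, le_rfl, fun P => ?_⟩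
      rw [blendedTarget, if_neg hx]
      ring
  rw [hw, hw, ← mul_sub, abs_mul, abs_of_nonneg (by positivity)]
  gcongr

lemma abs_blendedTarget_sub_self_le {X : Type*} {U : Set X} {H : X → ℝ} {α β N : ℝ}
    (hα : α ≤ 1) (hβ : β ≤ 1) {Q : X → ℝ} (hN : ∀ x, |Q x| ≤ N)
    (hU : ∀ x ∈ U, |1 - 1 / H x| * |Q x| ≤ (1 - β) * N) (x : X) :
    |blendedTarget U H α β Q x - Q x| ≤ (1 - α) * ((1 - β) * N) := by
  have hα' : 0 ≤ 1 - α := by linarith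
  have hβ' : 0 ≤ 1 - β := by linarith
  by_cases hx : x ∈ U
  · have h : blendedTarget U H α β Q x - Q x = -((1 - α) * ((1 - 1 / H x) * Q x)) := by
      rw [blendedTarget, if_pos hx]
      ring
    rw [h, abs_neg, abs_mul, abs_mul, abs_of_nonneg hα']
    exact mul_le_mul_of_nonneg_left (hU x hx) hα'
  · have h : blendedTarget U H α β Q x - Q x = -((1 - α) * ((1 - β) * Q x)) := by
      rw [blendedTarget, if_neg hx]
      ring
    rw [h, abs_neg, abs_mul, abs_mul, abs_of_nonneg hα', abs_of_nonneg hβ']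
    gcongr
    exact hN x

/-- Theorem 4 of the QDQ paper: if `Q^Δ` is a fixed point of the QDQ Bellman operator `𝓕` and
`Q*` is a fixed point of the classical Bellman operator `𝓑` (both bounded, with the relevant
sup-functions integrable), and the event hypothesis holds for `Q*`, then
`⨆ x, |Q^Δ(x) - Q*(x)| ≤ γ (1-α)(1-β) (1 - (α + (1-α)β) γ)⁻¹ ⨆ x, |Q*(x)|`. -/
theorem qdq_fixed_point_close_to_optimal {S A : Type*}
    [MeasurableSpace S] [MeasurableSpace A] [Nonempty S] [Nonempty A]
    (r : S × A → ℝ) (γ : ℝ) (hγ : γ ∈ Set.Ioo (0 : ℝ) 1)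
    (κ : Kernel (S × A) S) [IsMarkovKernel κ]
    (α β : ℝ) (hα : α ∈ Set.Icc (0 : ℝ) 1) (hβ : β ∈ Set.Icc (0 : ℝ) 1)
    (U : Set (S × A)) (H : S × A → ℝ)
    (hH : ∀ x ∈ U, 0 < H x) (hβH : ∀ x ∈ U, 1 ≤ β * H x)
    (QΔ Qstar : S × A → ℝ) (M : ℝ)
    (hQΔ : ∀ x, |QΔ x| ≤ M) (hQstar : ∀ x, |Qstar x| ≤ M)
    (hfixΔ : qdqBellman r γ κ U H α β QΔ = QΔ)
    (hfixStar : classicalBellman r γ κ Qstar = Qstar)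
    (hintGΔ : ∀ p : S × A,
      Integrable (fun s' => ⨆ a' : A, blendedTarget U H α β QΔ (s', a')) (κ p))
    (hintGstar : ∀ p : S × A,
      Integrable (fun s' => ⨆ a' : A, blendedTarget U H α β Qstar (s', a')) (κ p))
    (hintStar : ∀ p : S × A, Integrable (fun s' => ⨆ a' : A, Qstar (s', a')) (κ p))
    (hevent : ∀ x ∈ U, |1 - 1 / H x| * |Qstar x| ≤ (1 - β) * ⨆ y : S × A, |Qstar y|) :
    (⨆ x : S × A, |QΔ x - Qstar x|) ≤
      γ * (1 - α) * (1 - β) * (1 - (α + (1 - α) * β) * γ)⁻¹ * ⨆ x : S × A, |Qstar x| := by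
  set c := α + (1 - α) * β with hc
  set N := ⨆ x : S × A, |Qstar x|
  set D := ⨆ x : S × A, |QΔ x - Qstar x|
  have hα₂ : 0 ≤ 1 - α := by linarith [hα.2]
  have hc₀ : 0 ≤ c := add_nonneg hα.1 (mul_nonneg hα₂ hβ.1)
  have hc₁ : c ≤ 1 := by nlinarith [mul_le_mul_of_nonneg_left hβ.2 hα₂]
  have hN : ∀ x, |Qstar x| ≤ N := le_ciSup (f := fun x => |Qstar x|)
    ⟨M, Set.forall_mem_range.mpr hQstar⟩
  have hD : ∀ x, |QΔ x - Qstar x| ≤ D := le_ciSup (f := fun x => |QΔ x - Qstar x|)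
    ⟨M + M, Set.forall_mem_range.mpr fun x =>
      (abs_sub _ _).trans (add_le_add (hQΔ x) (hQstar x))⟩
  have hpoint : ∀ x, |blendedTarget U H α β QΔ x - Qstar x| ≤
      c * D + (1 - α) * ((1 - β) * N) := fun x =>
    (abs_sub_le _ (blendedTarget U H α β Qstar x) _).trans <| add_le_add
      ((abs_blendedTarget_sub_le hα hβ.1 hH hβH QΔ Qstar x).trans
        (mul_le_mul_of_nonneg_left (hD x) hc₀))
      (abs_blendedTarget_sub_self_le hα.2 hβ.2 hN hevent x)
  have hsup : ∀ s' : S, |(⨆ a' : A, blendedTarget U H α β QΔ (s', a')) - ⨆ a' : A, Qstar (s', a')|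
      ≤ c * D + (1 - α) * ((1 - β) * N) := fun s' =>
    abs_ciSup_sub_ciSup_le
      ⟨M + (c * D + (1 - α) * ((1 - β) * N)), Set.forall_mem_range.mpr fun a' => by
        linarith [(abs_le.mp (hpoint (s', a'))).2, (abs_le.mp (hQstar (s', a'))).2]⟩
      ⟨M, Set.forall_mem_range.mpr fun a' => (abs_le.mp (hQstar (s', a'))).2⟩
      fun a' => hpoint (s', a')
  have hle : D ≤ γ * (c * D + (1 - α) * ((1 - β) * N)) := ciSup_le fun p => by
    rw [← congrFun hfixΔ p, ← congrFun hfixStar p, qdqBellman, classicalBellman,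
      add_sub_add_left_eq_sub, ← mul_sub, abs_mul, abs_of_pos hγ.1]
    exact mul_le_mul_of_nonneg_left
      (abs_integral_sub_integral_le (hintGΔ p) (hintStar p) hsup) hγ.1.le
  have hpos : 0 < 1 - c * γ := by nlinarith [hγ.1, hγ.2]
  rw [mul_right_comm, ← div_eq_mul_inv, le_div_iff₀ hpos]
  linarith
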